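/- arXiv:2312.09869 — 3 statements merged into one kernel-verified Lean document; each statement's English description precedes it below -/
import Mathlib

section
/- Let Θ be a finite set (of agent types), m ≥ 1, and let v : Θ → ℝ^m assign to each type a nonzero vector such that for all distinct θ, θ' ∈ Θ there is no scalar λ ∈ ℝ with v(θ) = λ·v(θ'). Fix any x̂ ∈ ℝ^m and r > 0. Then the map θ ↦ x̂ + (r/‖v(θ)‖)·v(θ) is injective, and for each θ its image is the unique maximizer of x ↦ ⟨v(θ), x⟩ over the closed ball {x : ‖x − x̂‖ ≤ r}. Consequently, each type θ is uniquely determined by its utility-maximizing choice from this ball. -/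
open Metric
open scoped RealInnerProductSpace

section LinearOnBall

variable {E : Type*} [NormedAddCommGroup E] [InnerProductSpace ℝ E]

theorem norm_div_norm_smul_self {r : ℝ} (hr : 0 ≤ r) {v : E} (hv : v ≠ 0) :
    ‖(r / ‖v‖) • v‖ = r := by
  rw [norm_smul, Real.norm_of_nonneg (by positivity), div_mul_cancel₀ _ (norm_ne_zero_iff.2 hv)]

theorem inner_div_norm_smul_self (r : ℝ) {v : E} (hv : v ≠ 0) :
    ⟪v, (r / ‖v‖) • v⟫ = r * ‖v‖ := by
  have := norm_ne_zero_iff.2 hv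
  rw [real_inner_smul_right, real_inner_self_eq_norm_sq]
  field_simp

theorem isMaxOn_inner_closedBall (c : E) (r : ℝ) {v : E} (hv : v ≠ 0) :
    IsMaxOn (fun x => ⟪v, x⟫) (closedBall c r) (c + (r / ‖v‖) • v) := by
  intro x hx
  rw [mem_closedBall_iff_norm] at hx
  have h : ⟪v, x - c⟫ ≤ ‖v‖ * r :=
    (real_inner_le_norm v (x - c)).trans (by gcongr)
  rw [inner_sub_right] at h
  simp only [Set.mem_ofPred_eq, inner_add_right, inner_div_norm_smul_self r hv]
  linarith

/-- Equality case of Cauchy-Schwarz on the ball of radius `r`. -/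
theorem eq_div_norm_smul_of_le_inner {r : ℝ} (hr : 0 ≤ r) {v w : E} (hv : v ≠ 0)
    (hw : ‖w‖ ≤ r) (h : r * ‖v‖ ≤ ⟪v, w⟫) : w = (r / ‖v‖) • v := by
  have hv' : 0 < ‖v‖ := norm_pos_iff.2 hv
  have hinner : r * r ≤ ⟪w, (r / ‖v‖) • v⟫ := by
    rw [real_inner_smul_right, real_inner_comm]
    calc r * r = r / ‖v‖ * (r * ‖v‖) := by field_simp
      _ ≤ r / ‖v‖ * ⟪v, w⟫ := by gcongr
  have hsq := norm_sub_sq_real w ((r / ‖v‖) • v)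
  rw [norm_div_norm_smul_self hr hv] at hsq
  have hw2 : ‖w‖ ^ 2 ≤ r ^ 2 := by gcongr
  have hle : ‖w - (r / ‖v‖) • v‖ ^ 2 ≤ 0 := by linarith
  exact sub_eq_zero.1 (norm_eq_zero.1 (pow_eq_zero_iff two_ne_zero |>.1
    (le_antisymm hle (sq_nonneg _))))

theorem eq_of_isMaxOn_inner_closedBall {c y : E} {r : ℝ} (hr : 0 ≤ r) {v : E} (hv : v ≠ 0)
    (hy : y ∈ closedBall c r) (hmax : IsMaxOn (fun x => ⟪v, x⟫) (closedBall c r) y) :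
    y = c + (r / ‖v‖) • v := by
  have hmem : c + (r / ‖v‖) • v ∈ closedBall c r := by
    rw [mem_closedBall_iff_norm, add_sub_cancel_left, norm_div_norm_smul_self hr hv]
  have h : ⟪v, c + (r / ‖v‖) • v⟫ ≤ ⟪v, y⟫ := hmax hmem
  rw [inner_add_right, inner_div_norm_smul_self r hv] at h
  rw [← eq_div_norm_smul_of_le_inner hr hv (mem_closedBall_iff_norm.1 hy)
    (by rw [inner_sub_right]; linarith), add_sub_cancel]

end LinearOnBall

/-- If each type `θ` in a finite type set has a nonzero utility vector `v θ`
and distinct types have non-parallel vectors, then the map sending each type to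
`xhat + (r/‖v θ‖) • v θ` is injective, and for each `θ` this point is the unique maximizer
of `x ↦ ⟪v θ, x⟫` over the closed ball of radius `r` around `xhat`.  Hence each type is
uniquely determined by its utility-maximizing choice from the ball menu. -/
theorem single_round_type_identification (Θ : Type*) [Fintype Θ] (m : ℕ) (hm : 1 ≤ m)
    (v : Θ → EuclideanSpace ℝ (Fin m)) (hv : ∀ θ, v θ ≠ 0)
    (hpar : ∀ θ θ' : Θ, θ ≠ θ' → ¬ ∃ l : ℝ, v θ = l • v θ')
    (xhat : EuclideanSpace ℝ (Fin m)) (r : ℝ) (hr : 0 < r) :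
    Function.Injective (fun θ : Θ => xhat + (r / ‖v θ‖) • v θ) ∧
    ∀ θ : Θ,
      IsMaxOn (fun x => ⟪v θ, x⟫) (closedBall xhat r) (xhat + (r / ‖v θ‖) • v θ) ∧
      ∀ y ∈ closedBall xhat r,
        IsMaxOn (fun x => ⟪v θ, x⟫) (closedBall xhat r) y →
        y = xhat + (r / ‖v θ‖) • v θ := by
  refine ⟨fun θ θ' h => ?_, fun θ => ⟨isMaxOn_inner_closedBall xhat r (hv θ), fun y hy hmax =>
    eq_of_isMaxOn_inner_closedBall hr.le (hv θ) hy hmax⟩⟩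
  by_contra hne
  have hpos : r / ‖v θ‖ ≠ 0 := div_ne_zero hr.ne' (norm_ne_zero_iff.2 (hv θ))
  refine hpar θ θ' hne ⟨(r / ‖v θ‖)⁻¹ * (r / ‖v θ'‖), ?_⟩
  rw [mul_smul, ← add_left_cancel h, inv_smul_smul₀ hpos]
end

section
/- Let Θ be a finite set with |Θ| ≥ 3, let M ⊂ ℝ be a nonempty finite set (a menu of one-dimensional leader strategies), and for each θ ∈ Θ let V^θ : ℝ → ℝ be a convex function (the follower utility of type θ). Suppose for each θ ∈ Θ there is a point x^θ ∈ M that is the unique maximizer of V^θ over M (i.e., V^θ(y) < V^θ(x^θ) for all y ∈ M with y ≠ x^θ). Then there exist distinct θ, θ' ∈ Θ with x^θ = x^{θ'}. In particular, the follower's type cannot be identified from the follower's choice out of the menu in a single round. -/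
/-- A strict maximizer of a convex function over a finite set of reals is an extreme element of
the set. -/
theorem ConvexOn.eq_min'_or_eq_max'_of_forall_lt {f : ℝ → ℝ} (hf : ConvexOn ℝ Set.univ f)
    {M : Finset ℝ} (hM : M.Nonempty) {a : ℝ} (ha : a ∈ M)
    (hmax : ∀ y ∈ M, y ≠ a → f y < f a) : a = M.min' hM ∨ a = M.max' hM := by
  by_contra! h
  have hle := hf.le_max_of_mem_Icc (Set.mem_univ _) (Set.mem_univ _)
    ⟨M.min'_le a ha, M.le_max' a ha⟩
  exact hle.not_gt (max_lt (hmax _ (M.min'_mem hM) h.1.symm) (hmax _ (M.max'_mem hM) h.2.symm))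


/-- If there are at least three follower types, each with a convex utility over
one-dimensional leader strategies, and each type has a unique utility-maximizing item in a
finite menu `M ⊂ ℝ`, then two distinct types must choose the same item: the follower's type
cannot be identified from its choice in a single round. -/
theorem impossibility_single_round_two_leader_actions (Θ : Type*) [Fintype Θ]
    (hΘ : 3 ≤ Fintype.card Θ) (M : Finset ℝ) (hM : M.Nonempty)
    (V : Θ → ℝ → ℝ) (hconv : ∀ θ : Θ, ConvexOn ℝ Set.univ (V θ))
    (x : Θ → ℝ) (hxM : ∀ θ : Θ, x θ ∈ M)
    (hmax : ∀ θ : Θ, ∀ y ∈ M, y ≠ x θ → V θ y < V θ (x θ)) :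
    ∃ θ θ' : Θ, θ ≠ θ' ∧ x θ = x θ' := by
  have hcard : ({M.min' hM, M.max' hM} : Finset ℝ).card < (Finset.univ : Finset Θ).card :=
    Finset.card_le_two.trans_lt hΘ
  obtain ⟨θ, -, θ', -, hne, heq⟩ := Finset.exists_ne_map_eq_of_card_lt_of_maps_to hcard
    (f := x) fun θ _ => by
      simpa using (hconv θ).eq_min'_or_eq_max'_of_forall_lt hM (hxM θ) (hmax θ)
  exact ⟨θ, θ', hne, heq⟩
end

section
/- Let m ≥ 4 be even and let N ≥ m be a real number. Consider the Stackelberg game where the leader has m actions, the follower has m + 2 actions, and a follower of type θ ⊆ {1,…,m} with |θ| = m/2 has reward columns: for j ∈ {1,…,m}, F^θ_{i,j} = 1 if i = j and −2/(m−2) otherwise; F^θ_{i,m+1} = −1/N³ for all i; and F^θ_{·,a*} = (1/N²)·v^θ where v^θ_i = 1 if i ∈ θ and −N otherwise. For each half-size subset θ', define the leader strategy x^{θ'} ∈ ℝ^m by x^{θ'}_i = 2/m if i ∈ θ' and 0 otherwise, and let V^θ(x, j) = Σ_{i=1}^m x_i F^θ_{i,j}. Then for every half-size θ: V^θ(x^θ,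 a*) = 1/N², and for every pair (θ', a) with θ' half-size, a an action of the follower, and (θ', a) ≠ (θ, a*), it holds that V^θ(x^{θ'}, a) < 1/N². Consequently, each follower type θ strictly prefers the pair (x^θ, a*) to all other menu-item/response pairs, so the follower's choice from the menu {x^{θ'}} together with its response identifies θ in a single round. -/
/-- The follower reward matrix of the hard instance of Peng et al.: the follower of type
`θ ⊆ {1,…,m}` has, for each action `j` with `(j : ℕ) < m`, a column with `1` in row `j` and
`-2/(m-2)` elsewhere; for the action with index `m`, the constant column `-1/N³`; and for
the last action `a⋆`, the column `(1/N²) • v^θ` where `v^θ` has entries `1` on `θ` and `-N`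
off `θ`. -/
noncomputable def pengReward (m : ℕ) (N : ℝ) (θ : Finset (Fin m))
    (i : Fin m) (j : Fin (m + 2)) : ℝ :=
  if h : (j : ℕ) < m then (if i = ⟨(j : ℕ), h⟩ then 1 else -2 / ((m : ℝ) - 2))
  else if (j : ℕ) = m then -1 / N ^ 3
  else (1 / N ^ 2) * (if i ∈ θ then 1 else -N)

/-- The leader strategy posted for type `θ'`: probability `2/m` on each action in `θ'`. -/
noncomputable def pengStrategy (m : ℕ) (θ' : Finset (Fin m)) (i : Fin m) : ℝ :=
  if i ∈ θ' then 2 / (m : ℝ) else 0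

/-- Follower utility `V^θ(x, j) = ∑ i, x i * F^θ i j` in the hard instance. -/
noncomputable def pengUtility (m : ℕ) (N : ℝ) (θ : Finset (Fin m))
    (x : Fin m → ℝ) (j : Fin (m + 2)) : ℝ :=
  ∑ i : Fin m, x i * pengReward m N θ i j

theorem pengUtility_pengStrategy (m : ℕ) (N : ℝ) (θ θ' : Finset (Fin m)) (j : Fin (m + 2)) :
    pengUtility m N θ (pengStrategy m θ') j =
      2 / (m : ℝ) * ∑ i ∈ θ', pengReward m N θ i j := by
  simp [pengUtility, pengStrategy, Finset.mul_sum, ite_mul]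

theorem pengReward_last (m : ℕ) (N : ℝ) (θ : Finset (Fin m)) (i : Fin m) :
    pengReward m N θ i (Fin.last (m + 1)) = 1 / N ^ 2 * (if i ∈ θ then 1 else -N) := by
  simp [pengReward]

theorem cast_card_half_size {m : ℕ} (hme : Even m) {θ : Finset (Fin m)}
    (hθ : θ.card = m / 2) : (θ.card : ℝ) = m / 2 := by
  rw [hθ, Nat.cast_div hme.two_dvd two_ne_zero, Nat.cast_ofNat]

theorem pengUtility_self_last {m : ℕ} (hm : 0 < m) (hme : Even m) (N : ℝ)
    {θ : Finset (Fin m)} (hθ : θ.card = m / 2) :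
    pengUtility m N θ (pengStrategy m θ) (Fin.last (m + 1)) = 1 / N ^ 2 := by
  have hm' : (m : ℝ) ≠ 0 := by positivity
  rw [pengUtility_pengStrategy, Finset.sum_congr rfl (g := fun _ ↦ 1 / N ^ 2)
    fun i hi ↦ by rw [pengReward_last, if_pos hi, mul_one], Finset.sum_const, nsmul_eq_mul,
    cast_card_half_size hme hθ]
  field_simp

theorem pengUtility_last_lt {m : ℕ} (hm : 0 < m) (hme : Even m) {N : ℝ} (hN : 0 < N)
    {θ θ' : Finset (Fin m)} (hθ : θ.card = m / 2) (hθ' : θ'.card = m / 2) (hne : θ' ≠ θ) :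
    pengUtility m N θ (pengStrategy m θ') (Fin.last (m + 1)) < 1 / N ^ 2 := by
  obtain ⟨k, hk, hkθ⟩ : ∃ k ∈ θ', k ∉ θ := Finset.not_subset.1 fun h ↦
    hne (Finset.eq_of_subset_of_card_le h (by rw [hθ, hθ']))
  rw [← pengUtility_self_last hm hme N hθ', pengUtility_pengStrategy, pengUtility_pengStrategy]
  have hlt : ∑ i ∈ θ', pengReward m N θ i (Fin.last (m + 1)) <
      ∑ i ∈ θ', pengReward m N θ' i (Fin.last (m + 1)) := by
    have hN2 : 0 < 1 / N ^ 2 := by positivity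
    refine Finset.sum_lt_sum (fun i hi ↦ ?_) ⟨k, hk, ?_⟩
    · rw [pengReward_last, pengReward_last, if_pos hi]
      gcongr
      split_ifs <;> linarith
    · rw [pengReward_last, pengReward_last, if_pos hk, if_neg hkθ]
      gcongr
      linarith
  gcongr

theorem pengUtility_nonpos_of_lt {m : ℕ} (hm : 2 < m) (hme : Even m) (N : ℝ)
    (θ : Finset (Fin m)) {θ' : Finset (Fin m)} (hθ' : θ'.card = m / 2) {j : Fin (m + 2)}
    (hj : (j : ℕ) < m) : pengUtility m N θ (pengStrategy m θ') j ≤ 0 := by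
  have hm' : (0 : ℝ) < m - 2 := by
    rw [sub_pos]
    exact_mod_cast hm
  have hsum : ∑ i ∈ θ', pengReward m N θ i j =
      if (⟨j, hj⟩ : Fin m) ∈ θ' then 0 else -(m / ((m : ℝ) - 2)) := by
    have hterm (i : Fin m) : pengReward m N θ i j =
        -2 / ((m : ℝ) - 2) + if i = ⟨j, hj⟩ then 1 - -2 / ((m : ℝ) - 2) else 0 := by
      simp only [pengReward, dif_pos hj]
      split_ifs <;> ring
    simp_rw [hterm]
    rw [Finset.sum_add_distrib, Finset.sum_const, nsmul_eq_mul, cast_card_half_size hme hθ',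
      Finset.sum_ite_eq']
    split_ifs <;> field_simp <;> ring
  rw [pengUtility_pengStrategy, hsum]
  refine mul_nonpos_of_nonneg_of_nonpos (by positivity) ?_
  split_ifs
  · exact le_rfl
  · exact neg_nonpos.2 (by positivity)

theorem pengUtility_nonpos_of_eq {m : ℕ} {N : ℝ} (hN : 0 < N) (θ θ' : Finset (Fin m))
    {j : Fin (m + 2)} (hj : (j : ℕ) = m) :
    pengUtility m N θ (pengStrategy m θ') j ≤ 0 := by
  rw [pengUtility_pengStrategy]
  refine mul_nonpos_of_nonneg_of_nonpos (by positivity) (Finset.sum_nonpos fun i _ ↦ ?_)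
  rw [pengReward, dif_neg hj.not_lt, if_pos hj, neg_div, neg_nonpos]
  positivity

/-- In the hard instance of Peng et al. with even `m ≥ 4` and `N ≥ m`, every
half-size follower type `θ` gets utility `1/N²` from choosing the menu item `x^θ` and
responding with the special action `a⋆` (the last action), and strictly less than `1/N²`
from any other menu-item/response pair `(θ', a) ≠ (θ, a⋆)`.  Hence the follower's choice
from the menu together with the response identifies `θ` in a single round. -/
theorem peng_menu_single_round (m : ℕ) (hm : 4 ≤ m) (hme : Even m)
    (N : ℝ) (hN : (m : ℝ) ≤ N) (θ : Finset (Fin m)) (hθ : θ.card = m / 2) :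
    pengUtility m N θ (pengStrategy m θ) (Fin.last (m + 1)) = 1 / N ^ 2 ∧
    ∀ θ' : Finset (Fin m), θ'.card = m / 2 → ∀ a : Fin (m + 2),
      (θ', a) ≠ (θ, Fin.last (m + 1)) →
      pengUtility m N θ (pengStrategy m θ') a < 1 / N ^ 2 := by
  have hm0 : 0 < m := by lia
  have hN0 : 0 < N := lt_of_lt_of_le (by exact_mod_cast hm0) hN
  have hN2 : 0 < 1 / N ^ 2 := by positivity
  refine ⟨pengUtility_self_last hm0 hme N hθ, fun θ' hθ' a hne ↦ ?_⟩
  rcases lt_trichotomy (a : ℕ) m with ha | ha | ha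
  · exact (pengUtility_nonpos_of_lt (by lia) hme N θ hθ' ha).trans_lt hN2
  · exact (pengUtility_nonpos_of_eq hN0 θ θ' ha).trans_lt hN2
  · obtain rfl : a = Fin.last (m + 1) := Fin.ext (by rw [Fin.val_last]; lia)
    exact pengUtility_last_lt hm0 hme hN0 hθ hθ' fun h ↦ hne (by rw [h])
end
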